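/- Let Φ be a norm on ℝ^{n+1}, Ω̂ ⊆ ℝ^n an open set, and Ê ∈ BV_loc(Ω̂). If the cylinder Ê × ℝ is a minimizer of P_Φ in Ω̂ × ℝ, then Ê is a minimizer of P_φ in Ω̂, where φ is the norm on ℝ^n defined as the dual of the restriction of Φ^o to the horizontal hyperplane, i.e. φ = (Φ^o(·,0))^o. -/

import Mathlib

open MeasureTheory Set Filter

noncomputable section

/-- `ℝ^n` with the Euclidean norm. -/
abbrev Rn (n : ℕ) := EuclideanSpace ℝ (Fin n)

/-- `ℝ^{n+1} = ℝ^n × ℝ`. -/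
abbrev Rn1 (n : ℕ) := Rn n × ℝ

/-- Euclidean dot product on `ℝ^n`. -/
def dotn {n : ℕ} (x y : Rn n) : ℝ := ∑ i, x i * y i

/-- Euclidean dot product on `ℝ^{n+1} = ℝ^n × ℝ`. -/
def dotp {n : ℕ} (x y : Rn1 n) : ℝ := dotn x.1 y.1 + x.2 * y.2

/-- Euclidean norm on `ℝ^{n+1} = ℝ^n × ℝ`. -/
def enorm1 {n : ℕ} (x : Rn1 n) : ℝ := Real.sqrt (dotp x x)

/-- `Ψ` is a norm on `ℝ^n`: convex, absolutely one-homogeneous and bounded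
below by a positive multiple of the Euclidean norm. -/
def IsNormN {n : ℕ} (Ψ : Rn n → ℝ) : Prop :=
  ConvexOn ℝ univ Ψ ∧ (∀ (c : ℝ) (ξ : Rn n), Ψ (c • ξ) = |c| * Ψ ξ) ∧
    ∃ c > (0:ℝ), ∀ ξ, c * ‖ξ‖ ≤ Ψ ξ

/-- `Φ` is a norm on `ℝ^{n+1}`. -/
def IsNorm1 {n : ℕ} (Φ : Rn1 n → ℝ) : Prop :=
  ConvexOn ℝ univ Φ ∧ (∀ (c : ℝ) (ξ : Rn1 n), Φ (c • ξ) = |c| * Φ ξ) ∧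
    ∃ c > (0:ℝ), ∀ ξ, c * enorm1 ξ ≤ Φ ξ

/-- Dual norm on `ℝ^n`: `Ψ^o(ξ*) = sup {ξ*·ξ : Ψ(ξ) ≤ 1}`. -/
def dualN {n : ℕ} (Ψ : Rn n → ℝ) (xs : Rn n) : ℝ :=
  sSup ((fun ξ => dotn xs ξ) '' {ξ | Ψ ξ ≤ 1})

/-- Dual norm on `ℝ^{n+1}`. -/
def dual1 {n : ℕ} (Φ : Rn1 n → ℝ) (xs : Rn1 n) : ℝ :=
  sSup ((fun ξ => dotp xs ξ) '' {ξ | Φ ξ ≤ 1})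

/-- `Φ` is cylindrical over `φ`: `Φ(ξ̂,ξ_{n+1}) = max (φ(ξ̂), |ξ_{n+1}|)`. -/
def Cylindrical {n : ℕ} (Φ : Rn1 n → ℝ) (φ : Rn n → ℝ) : Prop :=
  ∀ ξ : Rn1 n, Φ ξ = max (φ ξ.1) |ξ.2|

/-- `A` is an open set compactly contained in `O`. -/
def CpCtd {E : Type*} [TopologicalSpace E] (A O : Set E) : Prop :=
  IsOpen A ∧ IsCompact (closure A) ∧ closure A ⊆ O

/-- Divergence of a vector field on `ℝ^n`. -/
def divN {n : ℕ} (η : Rn n → Rn n) (x : Rn n) : ℝ :=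
  ∑ i, fderiv ℝ η x (EuclideanSpace.single i (1:ℝ)) i

/-- Divergence of a vector field on `ℝ^{n+1} = ℝ^n × ℝ`. -/
def div1 {n : ℕ} (η : Rn1 n → Rn1 n) (z : Rn1 n) : ℝ :=
  (∑ i, (fderiv ℝ η z (EuclideanSpace.single i (1:ℝ), (0:ℝ))).1 i) +
    (fderiv ℝ η z ((0 : Rn n), (1:ℝ))).2

/-- Admissible test vector fields on `ℝ^n`: `C^1`, compactly supported in `A`,
with values in the unit ball of `Ψ`. -/
def TestN {n : ℕ} (A : Set (Rn n)) (Ψ : Rn n → ℝ) (η : Rn n → Rn n) : Prop :=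
  ContDiff ℝ 1 η ∧ HasCompactSupport η ∧ tsupport η ⊆ A ∧ ∀ x, Ψ (η x) ≤ 1

/-- Admissible test vector fields on `ℝ^{n+1}`. -/
def Test1 {n : ℕ} (A : Set (Rn1 n)) (Φ : Rn1 n → ℝ) (η : Rn1 n → Rn1 n) : Prop :=
  ContDiff ℝ 1 η ∧ HasCompactSupport η ∧ tsupport η ⊆ A ∧ ∀ z, Φ (η z) ≤ 1

/-- The set of numbers whose supremum is the anisotropic perimeter `P_Ψ(E,A)` in `ℝ^n`. -/
def perSetN {n : ℕ} (Ψ : Rn n → ℝ) (E A : Set (Rn n)) : Set ℝ :=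
  {r | ∃ η, TestN A Ψ η ∧ r = -∫ x in E, divN η x}

/-- Anisotropic perimeter `P_Ψ(E,A)` in `ℝ^n`. -/
def PerN {n : ℕ} (Ψ : Rn n → ℝ) (E A : Set (Rn n)) : ℝ := sSup (perSetN Ψ E A)

/-- `E` has locally finite perimeter in `O ⊆ ℝ^n`. -/
def BVlocSetN {n : ℕ} (O E : Set (Rn n)) : Prop :=
  ∀ A, CpCtd A O → BddAbove (perSetN (fun x => ‖x‖) E A)

/-- `E` is a minimizer of `P_Ψ` (by compact perturbations) in `O ⊆ ℝ^n`. -/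
def MinPerN {n : ℕ} (Ψ : Rn n → ℝ) (O E : Set (Rn n)) : Prop :=
  BVlocSetN O E ∧ ∀ A, CpCtd A O → ∀ F, BVlocSetN O F →
    IsCompact (closure (symmDiff E F)) → closure (symmDiff E F) ⊆ A →
      PerN Ψ E A ≤ PerN Ψ F A

/-- The set of numbers whose supremum is the anisotropic perimeter `P_Φ(E,A)` in `ℝ^{n+1}`. -/
def perSet1 {n : ℕ} (Φ : Rn1 n → ℝ) (E A : Set (Rn1 n)) : Set ℝ :=
  {r | ∃ η, Test1 A Φ η ∧ r = -∫ z in E, div1 η z}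

/-- Anisotropic perimeter `P_Φ(E,A)` in `ℝ^{n+1}`. -/
def Per1 {n : ℕ} (Φ : Rn1 n → ℝ) (E A : Set (Rn1 n)) : ℝ := sSup (perSet1 Φ E A)

/-- `E` has locally finite perimeter in `O ⊆ ℝ^{n+1}`. -/
def BVlocSet1 {n : ℕ} (O E : Set (Rn1 n)) : Prop :=
  ∀ A, CpCtd A O → BddAbove (perSet1 enorm1 E A)

/-- `E` is a minimizer of `P_Φ` (by compact perturbations) in `O ⊆ ℝ^{n+1}`. -/
def MinPer1 {n : ℕ} (Φ : Rn1 n → ℝ) (O E : Set (Rn1 n)) : Prop :=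
  BVlocSet1 O E ∧ ∀ A, CpCtd A O → ∀ F, BVlocSet1 O F →
    IsCompact (closure (symmDiff E F)) → closure (symmDiff E F) ⊆ A →
      Per1 Φ E A ≤ Per1 Φ F A

/-- The set of numbers whose supremum is the total variation `TV(u,A)`. -/
def varSet {n : ℕ} (A : Set (Rn n)) (u : Rn n → ℝ) : Set ℝ :=
  {r | ∃ η, TestN A (fun x => ‖x‖) η ∧ r = ∫ x in A, u x * divN η x}

/-- Total variation `TV(u,A)`. -/
def TV {n : ℕ} (u : Rn n → ℝ) (A : Set (Rn n)) : ℝ := sSup (varSet A u)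

/-- `u ∈ BV_loc(Ω̂)`. -/
def BVlocFun {n : ℕ} (Ω : Set (Rn n)) (u : Rn n → ℝ) : Prop :=
  (∀ A, CpCtd A Ω → IntegrableOn u A) ∧ ∀ A, CpCtd A Ω → BddAbove (varSet A u)

/-- The set of numbers whose supremum is `G_{Φ^o}(u,A)`. -/
def Gset {n : ℕ} (Φ : Rn1 n → ℝ) (A : Set (Rn n)) (u : Rn n → ℝ) : Set ℝ :=
  {r | ∃ η : Rn n → Rn1 n, ContDiff ℝ 1 η ∧ HasCompactSupport η ∧ tsupport η ⊆ A ∧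
    (∀ x, Φ (η x) ≤ 1) ∧ r = ∫ x in A, (u x * divN (fun y => (η y).1) x + (η x).2)}

/-- The functional `G_{Φ^o}(u,A)`. -/
def Gfun {n : ℕ} (Φ : Rn1 n → ℝ) (u : Rn n → ℝ) (A : Set (Rn n)) : ℝ := sSup (Gset Φ A u)

/-- `w` has compact support contained in `A`. -/
def CptSupp {n : ℕ} (A : Set (Rn n)) (w : Rn n → ℝ) : Prop :=
  IsCompact (tsupport w) ∧ tsupport w ⊆ A

/-- `u` is a minimizer of `G_{Φ^o}` by compact perturbations in `Ω̂`,
i.e. `u ∈ M_{Φ^o}(Ω̂)`. -/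
def MinG {n : ℕ} (Φ : Rn1 n → ℝ) (Ω : Set (Rn n)) (u : Rn n → ℝ) : Prop :=
  BVlocFun Ω u ∧ ∀ A, CpCtd A Ω → ∀ v, BVlocFun Ω v →
    CptSupp A (fun x => u x - v x) → Gfun Φ u A ≤ Gfun Φ v A

/-- `u` is a minimizer of the total variation by compact perturbations in `Ω̂`. -/
def MinTV {n : ℕ} (Ω : Set (Rn n)) (u : Rn n → ℝ) : Prop :=
  BVlocFun Ω u ∧ ∀ A, CpCtd A Ω → ∀ v, BVlocFun Ω v →
    CptSupp A (fun x => u x - v x) → TV u A ≤ TV v A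

/-- Subgraph of `u : Ω̂ → ℝ`. -/
def sg {n : ℕ} (Ω : Set (Rn n)) (u : Rn n → ℝ) : Set (Rn1 n) :=
  {p | p.1 ∈ Ω ∧ p.2 < u p.1}

/-- `S` is locally a Lipschitz graph at `p`. -/
def IsLocLipGraphAt {n : ℕ} (S : Set (Rn1 n)) (p : Rn1 n) : Prop :=
  ∃ U : Set (Rn1 n), IsOpen U ∧ p ∈ U ∧ ∃ e : Rn1 n, enorm1 e = 1 ∧
    ∃ g : Rn1 n → ℝ, (∃ L : NNReal, LipschitzOnWith L g {y | dotp y e = 0}) ∧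
      S ∩ U = {z | ∃ y, dotp y e = 0 ∧ z = y + g y • e} ∩ U

/-- `Φ` is a partially monotone norm on `ℝ^{n+1}`. -/
def PartMono {n : ℕ} (Φ : Rn1 n → ℝ) : Prop :=
  ∀ ξ η : Rn1 n, Φ (ξ.1, 0) ≤ Φ (η.1, 0) → Φ ((0 : Rn n), ξ.2) ≤ Φ ((0 : Rn n), η.2) →
    Φ ξ ≤ Φ η

end


lemma dotn_eq_inner {n : ℕ} (x y : Rn n) : dotn x y = inner ℝ y x := by
  simp [dotn, PiLp.inner_apply]

lemma norm_fst_le_enorm1 {n : ℕ} (ξ : Rn1 n) : ‖ξ.1‖ ≤ enorm1 ξ := by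
  apply Real.le_sqrt_of_sq_le
  simp only [dotp, dotn_eq_inner, real_inner_self_eq_norm_sq]
  nlinarith [mul_self_nonneg ξ.2]

lemma abs_snd_le_enorm1 {n : ℕ} (ξ : Rn1 n) : |ξ.2| ≤ enorm1 ξ := by
  apply Real.le_sqrt_of_sq_le
  simp only [dotp, dotn_eq_inner, real_inner_self_eq_norm_sq, sq_abs]
  nlinarith [sq_nonneg ‖ξ.1‖]

lemma dotp_horiz {n : ℕ} (x : Rn n) (ζ : Rn1 n) : dotp (x, (0:ℝ)) ζ = dotn x ζ.1 := by
  simp [dotp]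

lemma dotn_comm' {n : ℕ} (x y : Rn n) : dotn x y = dotn y x := by
  simp [dotn, mul_comm]

lemma IsNorm1.cont {n : ℕ} {Φ : Rn1 n → ℝ} (h : IsNorm1 Φ) : Continuous Φ :=
  h.1.locallyLipschitz.continuous

lemma IsNorm1.zero {n : ℕ} {Φ : Rn1 n → ℝ} (h : IsNorm1 Φ) : Φ 0 = 0 := by
  simpa using h.2.1 0 0

lemma IsNorm1.smul_le {n : ℕ} {Φ : Rn1 n → ℝ} (h : IsNorm1 Φ) {c : ℝ} (hc : 0 ≤ c) (hc1 : c ≤ 1)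
    {ξ : Rn1 n} (hξ : Φ ξ ≤ 1) : Φ (c • ξ) ≤ 1 := by
  rw [h.2.1, abs_of_nonneg hc]
  nlinarith

lemma IsNorm1.bdd {n : ℕ} {Φ : Rn1 n → ℝ} (h : IsNorm1 Φ) :
    ∃ M > (0:ℝ), ∀ ξ, Φ ξ ≤ 1 → ‖ξ.1‖ ≤ M ∧ |ξ.2| ≤ M := by
  obtain ⟨c, hc, hb⟩ := h.2.2
  refine ⟨1 / c, by positivity, fun ξ hξ => ?_⟩
  have h1 := hb ξ
  have h2 := norm_fst_le_enorm1 ξ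
  have h3 := abs_snd_le_enorm1 ξ
  rw [le_div_iff₀ hc, le_div_iff₀ hc]
  constructor <;> nlinarith

lemma IsNorm1.dual_bdd {n : ℕ} {Φ : Rn1 n → ℝ} (h : IsNorm1 Φ) (xs : Rn n) :
    BddAbove ((fun ξ => dotp (xs, (0:ℝ)) ξ) '' {ξ | Φ ξ ≤ 1}) := by
  obtain ⟨M, hM, hb⟩ := h.bdd
  refine ⟨‖xs‖ * M, ?_⟩
  rintro _ ⟨ξ, hξ, rfl⟩
  simp only [dotp_horiz, dotn_eq_inner]
  rw [real_inner_comm]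
  exact (real_inner_le_norm _ _).trans (by gcongr; exact (hb ξ hξ).1)

/-- The norm of the section. -/
noncomputable def phiOf {n : ℕ} (Φ : Rn1 n → ℝ) : Rn n → ℝ := dualN (fun xs : Rn n => dual1 Φ (xs, (0:ℝ)))

lemma phi_le {n : ℕ} {Φ : Rn1 n → ℝ} (h : IsNorm1 Φ) {ξ : Rn1 n} (hξ : Φ ξ ≤ 1) :
    phiOf Φ ξ.1 ≤ 1 := by
  apply Real.sSup_le _ zero_le_one
  rintro _ ⟨xs, hxs, rfl⟩
  simp only
  rw [dotn_comm', ← dotp_horiz xs ξ]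
  exact (le_csSup (h.dual_bdd xs) ⟨ξ, hξ, rfl⟩).trans hxs

lemma IsNorm1.dual_bdd2 {n : ℕ} {Φ : Rn1 n → ℝ} (h : IsNorm1 Φ) (ξ : Rn n) :
    BddAbove ((fun xs => dotn ξ xs) '' {xs : Rn n | dual1 Φ (xs, (0:ℝ)) ≤ 1}) := by
  obtain ⟨c, hc, hb⟩ := h.2.2
  have h0 : 0 ≤ Φ (ξ, 0) := le_trans (mul_nonneg hc.le (Real.sqrt_nonneg _)) (hb _)
  refine ⟨Φ (ξ, 0) + 1, ?_⟩
  rintro _ ⟨xs, hxs, rfl⟩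
  have hp : 0 < Φ (ξ, 0) + 1 := by linarith
  have h1 : Φ ((Φ (ξ, 0) + 1)⁻¹ • (ξ, (0:ℝ))) ≤ 1 := by
    rw [h.2.1, abs_of_pos (inv_pos.2 hp), inv_mul_le_iff₀ hp]
    linarith
  have h2 := (le_csSup (h.dual_bdd xs) ⟨_, h1, rfl⟩).trans hxs
  simp only [dotp_horiz, Prod.smul_fst, dotn_eq_inner, real_inner_smul_left] at h2
  rw [inv_mul_le_iff₀ hp, mul_one] at h2
  simpa [dotn_eq_inner, real_inner_comm] using h2

lemma phi_lift {n : ℕ} {Φ : Rn1 n → ℝ} (h : IsNorm1 Φ) {ξ : Rn n} (hξ : phiOf Φ ξ ≤ 1)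
    {r : ℝ} (hr0 : 0 < r) (hr : r < 1) : ∃ c : ℝ, Φ (r • ξ, c) < 1 := by
  by_contra hcon
  push Not at hcon
  set K : Set (Rn n) := Prod.fst '' {z : Rn1 n | Φ z < 1} with hK
  have hKo : IsOpen K := isOpenMap_fst _ (isOpen_lt h.cont continuous_const)
  have hKc : Convex ℝ K := by
    have : Convex ℝ {z : Rn1 n | Φ z < 1} := by simpa using h.1.convex_lt 1
    exact this.linear_image (LinearMap.fst ℝ (Rn n) ℝ)
  have hnot : r • ξ ∉ K := by
    rintro ⟨⟨a, b⟩, hz, he⟩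
    simp only at he
    subst he
    exact absurd hz (not_lt.2 (hcon b))
  obtain ⟨f, hf⟩ := geometric_hahn_banach_open_point hKc hKo hnot
  have h0K : (0 : Rn n) ∈ K := ⟨0, by simp [h.zero], rfl⟩
  have hpos : 0 < f (r • ξ) := by simpa using hf 0 h0K
  set v := (InnerProductSpace.toDual ℝ (Rn n)).symm f with hv
  have hfv : ∀ x, f x = inner ℝ v x := fun x => by simp [hv]
  set xs := (f (r • ξ))⁻¹ • v with hxs
  have hd : ∀ x, dotn xs x = (f (r • ξ))⁻¹ * f x := fun x => by
    rw [dotn_eq_inner, real_inner_comm, hxs, real_inner_smul_left, hfv x]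
  have hdual : dual1 Φ (xs, (0:ℝ)) ≤ 1 := by
    apply Real.sSup_le _ zero_le_one
    rintro _ ⟨ζ, hζ, rfl⟩
    simp only [dotp_horiz, hd]
    rw [inv_mul_le_iff₀ hpos, mul_one]
    by_contra hlt
    push Not at hlt
    have hζp : 0 < f ζ.1 := hpos.trans hlt
    have hs0 : 0 < f (r • ξ) / f ζ.1 := div_pos hpos hζp
    have hs1 : f (r • ξ) / f ζ.1 < 1 := (div_lt_one hζp).2 hlt
    have hmem : (f (r • ξ) / f ζ.1) • ζ.1 ∈ K := ⟨(f (r • ξ) / f ζ.1) • ζ, by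
        simp only [mem_ofPred_eq, h.2.1, abs_of_pos hs0]
        have : Φ ζ ≤ 1 := hζ
        nlinarith, rfl⟩
    have h5 := hf _ hmem
    rw [map_smul f (f (r • ξ) / f ζ.1), smul_eq_mul, div_mul_cancel₀ _ hζp.ne'] at h5
    exact lt_irrefl _ h5
  have h3 := (le_csSup (h.dual_bdd2 ξ) ⟨xs, hdual, rfl⟩).trans hξ
  simp only at h3
  rw [dotn_comm', hd, inv_mul_le_iff₀ hpos, mul_one, map_smul, smul_eq_mul] at h3
  rw [map_smul, smul_eq_mul] at hpos
  have : 0 < f ξ := by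
    by_contra hh
    push Not at hh
    nlinarith
  nlinarith

lemma phi_bdd {n : ℕ} {Φ : Rn1 n → ℝ} (h : IsNorm1 Φ) :
    ∃ M > (0:ℝ), ∀ ξ : Rn n, phiOf Φ ξ ≤ 1 → ‖ξ‖ ≤ M := by
  obtain ⟨M, hM, hb⟩ := h.bdd
  refine ⟨2 * M, by positivity, fun ξ hξ => ?_⟩
  obtain ⟨c, hc⟩ := phi_lift h hξ (r := 1/2) (by norm_num) (by norm_num)
  have := (hb _ hc.le).1
  simp only [norm_smul] at this
  norm_num at this
  linarith

/-- Horizontal divergence. -/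
noncomputable def hdiv {n : ℕ} (η : Rn1 n → Rn1 n) (z : Rn1 n) : ℝ :=
  ∑ i, (fderiv ℝ η z (EuclideanSpace.single i (1:ℝ), (0:ℝ))).1 i

/-- Vertical divergence. -/
noncomputable def vdiv {n : ℕ} (η : Rn1 n → Rn1 n) (z : Rn1 n) : ℝ :=
  (fderiv ℝ η z ((0 : Rn n), (1:ℝ))).2

lemma hdiv_eq {n : ℕ} {η : Rn1 n → Rn1 n} (h : ContDiff ℝ 1 η) (x : Rn n) (t : ℝ) :
    hdiv η (x, t) = divN (fun y => (η (y, t)).1) x := by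
  have h1 : HasFDerivAt (fun y : Rn n => (η (y, t)).1)
      (((ContinuousLinearMap.fst ℝ (Rn n) ℝ).comp (fderiv ℝ η (x, t))).comp
        (ContinuousLinearMap.inl ℝ (Rn n) ℝ)) x := by
    have h2 := ((h.differentiable one_ne_zero) (x, t)).hasFDerivAt
    have h3 : HasFDerivAt (fun y : Rn n => (y, t)) (ContinuousLinearMap.inl ℝ (Rn n) ℝ) x :=
      hasFDerivAt_prodMk_left x t
    have h4 : HasFDerivAt (fun z : Rn1 n => (η z).1)
        ((ContinuousLinearMap.fst ℝ (Rn n) ℝ).comp (fderiv ℝ η (x, t))) (x, t) :=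
      (ContinuousLinearMap.fst ℝ (Rn n) ℝ).hasFDerivAt.comp _ h2
    exact HasFDerivAt.comp (g := fun z : Rn1 n => (η z).1) x h4 h3
  simp [hdiv, divN, h1.fderiv]

lemma vdiv_hasDerivAt {n : ℕ} {η : Rn1 n → Rn1 n} (h : ContDiff ℝ 1 η) (x : Rn n) (t : ℝ) :
    HasDerivAt (fun s => (η (x, s)).2) (vdiv η (x, t)) t := by
  have h2 := ((h.differentiable one_ne_zero) (x, t)).hasFDerivAt
  have h3 : HasFDerivAt (fun y : ℝ => (x, y)) (ContinuousLinearMap.inr ℝ (Rn n) ℝ) t :=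
    hasFDerivAt_prodMk_right x t
  have := (((ContinuousLinearMap.snd ℝ (Rn n) ℝ).hasFDerivAt.comp _ h2).comp t h3).hasDerivAt
  simpa [vdiv, Function.comp_def] using this

lemma hdiv_cont {n : ℕ} {η : Rn1 n → Rn1 n} (h : ContDiff ℝ 1 η) : Continuous (hdiv η) := by
  have := h.continuous_fderiv one_ne_zero
  unfold hdiv
  fun_prop

lemma vdiv_cont {n : ℕ} {η : Rn1 n → Rn1 n} (h : ContDiff ℝ 1 η) : Continuous (vdiv η) := by
  have := h.continuous_fderiv one_ne_zero
  unfold vdiv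
  fun_prop

lemma hdiv_supp {n : ℕ} {η : Rn1 n → Rn1 n} (hs : HasCompactSupport η) :
    HasCompactSupport (hdiv η) := by
  refine (hs.fderiv ℝ).comp_left (g := fun L : Rn1 n →L[ℝ] Rn1 n =>
    ∑ i, (L (EuclideanSpace.single i (1:ℝ), (0:ℝ))).1 i) ?_
  simp

lemma vdiv_supp {n : ℕ} {η : Rn1 n → Rn1 n} (hs : HasCompactSupport η) :
    HasCompactSupport (vdiv η) := by
  refine (hs.fderiv ℝ).comp_left (g := fun L : Rn1 n →L[ℝ] Rn1 n =>
    (L ((0 : Rn n), (1:ℝ))).2) ?_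
  simp

lemma hdiv_int {n : ℕ} {η : Rn1 n → Rn1 n} (h : ContDiff ℝ 1 η) (hs : HasCompactSupport η) :
    Integrable (hdiv η) := (hdiv_cont h).integrable_of_hasCompactSupport (hdiv_supp hs)

lemma vdiv_int {n : ℕ} {η : Rn1 n → Rn1 n} (h : ContDiff ℝ 1 η) (hs : HasCompactSupport η) :
    Integrable (vdiv η) := (vdiv_cont h).integrable_of_hasCompactSupport (vdiv_supp hs)

lemma slice_int {n : ℕ} {f : Rn1 n → ℝ} (h : Continuous f) (hs : HasCompactSupport f) (x : Rn n) :
    Integrable (fun t => f (x, t)) := by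
  refine (h.comp (by fun_prop)).integrable_of_hasCompactSupport ?_
  refine HasCompactSupport.of_support_subset_isCompact (hs.isCompact.image continuous_snd) ?_
  intro t ht
  exact ⟨(x, t), subset_tsupport _ ht, rfl⟩

/-- Fubini for the horizontal part. -/
lemma hdiv_fubini {n : ℕ} {η : Rn1 n → Rn1 n} (h : ContDiff ℝ 1 η) (hs : HasCompactSupport η)
    (E : Set (Rn n)) (I : Set ℝ) :
    IntegrableOn (fun t => ∫ x in E, divN (fun y => (η (y, t)).1) x) I ∧
    ∫ z in E ×ˢ I, hdiv η z = ∫ t in I, ∫ x in E, divN (fun y => (η (y, t)).1) x := by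
  have hi : Integrable (hdiv η) (((volume : Measure (Rn n)).restrict E).prod
      ((volume : Measure ℝ).restrict I)) := by
    rw [Measure.prod_restrict]
    exact (hdiv_int h hs).integrableOn
  constructor
  · have := hi.integral_prod_right
    simp only [hdiv_eq h] at this
    exact this
  · rw [Measure.volume_eq_prod, ← Measure.prod_restrict, integral_prod_symm _ hi]
    simp only [hdiv_eq h]

lemma vdiv_univ {n : ℕ} {η : Rn1 n → Rn1 n} (h : ContDiff ℝ 1 η) (hs : HasCompactSupport η)
    (E : Set (Rn n)) : ∫ z in E ×ˢ (univ : Set ℝ), vdiv η z = 0 := by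
  rw [Measure.volume_eq_prod, setIntegral_prod _ (vdiv_int h hs).integrableOn]
  have : ∀ x : Rn n, ∫ t in (univ : Set ℝ), vdiv η (x, t) = 0 := by
    intro x
    rw [Measure.restrict_univ]
    refine integral_eq_zero_of_hasDerivAt_of_integrable (fun t => vdiv_hasDerivAt h x t)
      (slice_int (vdiv_cont h) (vdiv_supp hs) x) ?_
    refine slice_int (f := fun z => (η z).2) (continuous_snd.comp h.continuous) ?_ x
    exact hs.comp_left (g := Prod.snd) rfl
  simp only [this, integral_zero]

lemma vdiv_Icc {n : ℕ} {η : Rn1 n → Rn1 n} (h : ContDiff ℝ 1 η) (hs : HasCompactSupport η)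
    (E A : Set (Rn n)) (hA : IsOpen A) (hAf : volume A ≠ ⊤) {R M : ℝ} (hR : 0 ≤ R)
    (hM0 : 0 ≤ M)
    (hM : ∀ z, |(η z).2| ≤ M) (hsub : ∀ x t, x ∉ A → η (x, t) = 0) :
    |∫ z in E ×ˢ Icc (-R) R, vdiv η z| ≤ 2 * M * (volume A).toReal := by
  rw [Measure.volume_eq_prod, setIntegral_prod _ (vdiv_int h hs).integrableOn]
  have h1 : ∀ x : Rn n, ∫ t in Icc (-R) R, vdiv η (x, t) = (η (x, R)).2 - (η (x, -R)).2 := by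
    intro x
    rw [integral_Icc_eq_integral_Ioc, ← intervalIntegral.integral_of_le (by linarith)]
    refine intervalIntegral.integral_eq_sub_of_hasDerivAt (fun t _ => vdiv_hasDerivAt h x t) ?_
    exact ((vdiv_cont h).comp (by fun_prop)).intervalIntegrable _ _
  simp only [h1]
  have hint : Integrable (A.indicator (fun _ => 2 * M)) := by
    rw [integrable_indicator_iff hA.measurableSet]
    exact integrableOn_const hAf
  have h2 : ∀ x : Rn n, ‖(η (x, R)).2 - (η (x, -R)).2‖ ≤ A.indicator (fun _ => 2 * M) x := by
    intro x
    by_cases hx : x ∈ A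
    · rw [indicator_of_mem hx]
      refine (norm_sub_le _ _).trans ?_
      have := hM (x, R)
      have := hM (x, -R)
      simp only [Real.norm_eq_abs]
      linarith
    · simp [indicator_of_notMem hx, hsub x _ hx]
  calc _ ≤ ∫ x in E, A.indicator (fun _ => 2 * M) x :=
        norm_integral_le_of_norm_le hint.integrableOn (Eventually.of_forall h2)
    _ ≤ ∫ x, A.indicator (fun _ => 2 * M) x := by
        apply setIntegral_le_integral hint
        exact Eventually.of_forall fun x => indicator_nonneg (fun _ _ => by positivity) x
    _ = _ := by
        rw [integral_indicator hA.measurableSet]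
        simp [Measure.real, mul_comm]

/-- The competitor. -/
def cylComp {n : ℕ} (E F : Set (Rn n)) (R : ℝ) : Set (Rn1 n) :=
  F ×ˢ Icc (-R) R ∪ E ×ˢ (Icc (-R) R)ᶜ

lemma comp_self {n : ℕ} (E : Set (Rn n)) (R : ℝ) : cylComp E E R = E ×ˢ univ := by
  rw [cylComp, ← prod_union, union_compl_self]

lemma comp_integral {n : ℕ} {f : Rn1 n → ℝ} (hf : Integrable f) (E F : Set (Rn n)) (R : ℝ) :
    ∫ z in cylComp E F R, f z = (∫ z in F ×ˢ Icc (-R) R, f z) + ∫ z in E ×ˢ (Icc (-R) R)ᶜ, f z := by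
  have hm : MeasurableSet ((univ : Set (Rn n)) ×ˢ Icc (-R) R) :=
    MeasurableSet.univ.prod measurableSet_Icc
  have s1 : cylComp E F R ∩ ((univ : Set (Rn n)) ×ˢ Icc (-R) R) = F ×ˢ Icc (-R) R := by
    ext ⟨x, t⟩
    simp only [cylComp, mem_inter_iff, mem_union, mem_prod, mem_univ, mem_compl_iff]
    tauto
  have s2 : cylComp E F R \ ((univ : Set (Rn n)) ×ˢ Icc (-R) R) = E ×ˢ (Icc (-R) R)ᶜ := by
    ext ⟨x, t⟩
    simp only [cylComp, Set.mem_sdiff, mem_union, mem_prod, mem_univ, mem_compl_iff]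
    tauto
  rw [← integral_inter_add_sdiff hm hf.integrableOn, s1, s2]

lemma upper {n : ℕ} {η : Rn1 n → Rn1 n} (h : ContDiff ℝ 1 η) (hs : HasCompactSupport η)
    (E F A : Set (Rn n)) (hA : IsOpen A) (hAf : volume A ≠ ⊤) {R S M a b : ℝ} (hR : 0 ≤ R)
    (hRS : R < S) (hM0 : 0 ≤ M)
    (hM : ∀ z, |(η z).2| ≤ M) (hsub : tsupport η ⊆ A ×ˢ Ioo (-S) S)
    (ha : ∀ t, -∫ x in F, divN (fun y => (η (y, t)).1) x ≤ a)
    (hb : ∀ t, -∫ x in E, divN (fun y => (η (y, t)).1) x ≤ b) :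
    -∫ z in cylComp E F R, div1 η z ≤
      2 * R * a + 2 * (S - R) * b + 4 * M * (volume A).toReal := by
  have hz : ∀ z, z ∉ A ×ˢ Ioo (-S) S → η z = 0 := fun z hz =>
    image_eq_zero_of_notMem_tsupport fun h' => hz (hsub h')
  have hzA : ∀ x t, x ∉ A → η (x, t) = 0 := fun x t hx => hz _ fun h' => hx h'.1
  have e1 : div1 η = fun z => hdiv η z + vdiv η z := rfl
  have hh := hdiv_int h hs
  have hv := vdiv_int h hs
  have e2 : ∫ z in cylComp E F R, div1 η z
      = (∫ z in cylComp E F R, hdiv η z) + ∫ z in cylComp E F R, vdiv η z := by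
    rw [e1]; exact integral_add hh.integrableOn hv.integrableOn
  have e3 := comp_integral hh E F R
  have e4 := comp_integral hv E F R
  have e5 := comp_integral hv E E R
  rw [comp_self, vdiv_univ h hs] at e5
  have b1 := abs_le.1 (vdiv_Icc h hs F A hA hAf hR hM0 hM hzA)
  have b2 := abs_le.1 (vdiv_Icc h hs E A hA hAf hR hM0 hM hzA)
  obtain ⟨i1, f1⟩ := hdiv_fubini h hs F (Icc (-R) R)
  obtain ⟨i2, f2⟩ := hdiv_fubini h hs E (Icc (-R) R)ᶜ
  have c1 : -∫ t in Icc (-R) R, ∫ x in F, divN (fun y => (η (y, t)).1) x ≤ 2 * R * a := by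
    rw [← integral_neg]
    have : ∫ t in Icc (-R) R, a = 2 * R * a := by
      rw [setIntegral_const, smul_eq_mul, Measure.real, Real.volume_Icc, ENNReal.toReal_ofReal (by linarith)]
      ring
    rw [← this]
    exact setIntegral_mono i1.neg (integrableOn_const (by simp)) ha
  have c2 : -∫ t in (Icc (-R) R)ᶜ, ∫ x in E, divN (fun y => (η (y, t)).1) x ≤ 2 * (S - R) * b := by
    rw [← integral_neg]
    have hint : Integrable ((Ioo (-S) S).indicator (fun _ => b)) := by
      rw [integrable_indicator_iff measurableSet_Ioo]
      exact integrableOn_const (by simp)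
    have : ∫ t in (Icc (-R) R)ᶜ, (Ioo (-S) S).indicator (fun _ => b) t = 2 * (S - R) * b := by
      have k1 := integral_add_compl (measurableSet_Icc (a := -R) (b := R)) hint
      have k2 : ∫ t in Icc (-R) R, (Ioo (-S) S).indicator (fun _ => b) t = 2 * R * b := by
        rw [setIntegral_congr_fun (g := fun _ => b) measurableSet_Icc]
        · rw [setIntegral_const, smul_eq_mul, Measure.real, Real.volume_Icc, ENNReal.toReal_ofReal (by linarith)]
          ring
        · intro t ht
          have ht' : t ∈ Ioo (-S) S := ⟨by linarith [ht.1], by linarith [ht.2]⟩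
          exact indicator_of_mem ht' _
      have k3 : ∫ t, (Ioo (-S) S).indicator (fun _ => b) t = 2 * S * b := by
        rw [integral_indicator measurableSet_Ioo]
        rw [setIntegral_const, smul_eq_mul, Measure.real, Real.volume_Ioo, ENNReal.toReal_ofReal (by linarith)]
        ring
      linarith
    rw [← this]
    refine setIntegral_mono i2.neg hint.integrableOn fun t => ?_
    by_cases ht : t ∈ Ioo (-S) S
    · rw [indicator_of_mem ht]; exact hb t
    · rw [indicator_of_notMem ht]
      have : ∀ y : Rn n, (η (y, t)).1 = 0 := fun y => by
        rw [hz _ fun h' => ht h'.2]; rfl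
      simp [this, divN]
  rw [e2, e3, e4, f1, f2]
  linarith [b1.1, b1.2, b2.1, b2.2]

lemma slice_test {n : ℕ} {η : Rn1 n → Rn1 n} (h : ContDiff ℝ 1 η) (hs : HasCompactSupport η)
    {A : Set (Rn n)} {J : Set ℝ} (hsub : tsupport η ⊆ A ×ˢ J) {ψ : Rn n → ℝ}
    (hψ : ∀ z, ψ (η z).1 ≤ 1) (t : ℝ) : TestN A ψ (fun y => (η (y, t)).1) := by
  have hc : IsCompact (Prod.fst '' tsupport η) := hs.isCompact.image continuous_fst
  have hsup : Function.support (fun y => (η (y, t)).1) ⊆ Prod.fst '' tsupport η := by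
    intro y hy
    refine ⟨(y, t), subset_tsupport _ ?_, rfl⟩
    intro h0
    apply hy
    simp [h0]
  refine ⟨?_, HasCompactSupport.of_support_subset_isCompact hc hsup, ?_, fun y => hψ _⟩
  · fun_prop
  · refine (closure_minimal hsup hc.isClosed).trans ?_
    rintro _ ⟨z, hz, rfl⟩
    exact (hsub hz).1

lemma upper_bdd {n : ℕ} {Ψ : Rn1 n → ℝ} {ψ : Rn n → ℝ} {M : ℝ} (hM0 : 0 ≤ M)
    (hΨ : ∀ ξ, Ψ ξ ≤ 1 → ψ ξ.1 ≤ 1 ∧ |ξ.2| ≤ M) {E F A : Set (Rn n)} (hA : IsOpen A)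
    (hAf : volume A ≠ ⊤) (bE : BddAbove (perSetN ψ E A)) (bF : BddAbove (perSetN ψ F A))
    {R S : ℝ} (hR : 0 ≤ R) (hRS : R < S) {A' : Set (Rn1 n)} (hA' : A' ⊆ A ×ˢ Ioo (-S) S) :
    ∀ r ∈ perSet1 Ψ (cylComp E F R) A',
      r ≤ 2 * R * PerN ψ F A + 2 * (S - R) * PerN ψ E A + 4 * M * (volume A).toReal := by
  rintro _ ⟨η, ⟨h, hs, hsub, hb⟩, rfl⟩
  have ht := slice_test h hs (hsub.trans hA') (ψ := ψ) (fun z => (hΨ _ (hb z)).1)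
  exact upper h hs E F A hA hAf hR hRS hM0 (fun z => (hΨ _ (hb z)).2) (hsub.trans hA')
    (fun t => le_csSup bF ⟨_, ht t, rfl⟩) (fun t => le_csSup bE ⟨_, ht t, rfl⟩)

lemma divN_smul {n : ℕ} {η : Rn n → Rn n} (h : ContDiff ℝ 1 η) (c : ℝ) (x : Rn n) :
    divN (fun y => c • η y) x = c * divN η x := by
  have := fderiv_fun_const_smul ((h.differentiable one_ne_zero) x) c
  simp [divN, this, Finset.mul_sum]

lemma phi_per_bdd {n : ℕ} {Φ : Rn1 n → ℝ} (hΦ : IsNorm1 Φ) {E A : Set (Rn n)}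
    (hb : BddAbove (perSetN (fun x => ‖x‖) E A)) : BddAbove (perSetN (phiOf Φ) E A) := by
  obtain ⟨M, hM, hbd⟩ := phi_bdd hΦ
  obtain ⟨B, hB⟩ := hb
  refine ⟨M * B, ?_⟩
  rintro _ ⟨η, ⟨h, hs, hsub, hη⟩, rfl⟩
  have hsm : tsupport (fun y => M⁻¹ • η y) ⊆ tsupport η :=
    closure_mono fun y hy h0 => hy (by simp [h0])
  have := hB ⟨fun y => M⁻¹ • η y, ⟨h.const_smul _, ?_, hsm.trans hsub, fun x => ?_⟩, rfl⟩
  · simp only [divN_smul h, integral_const_mul] at this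
    rw [← mul_neg, inv_mul_le_iff₀ hM] at this
    exact this
  · exact hs.isCompact.of_isClosed_subset (isClosed_tsupport _) hsm
  · simp only [norm_smul, norm_inv, Real.norm_eq_abs, abs_of_pos hM]
    rw [inv_mul_le_iff₀ hM, mul_one]
    exact hbd _ (hη x)

lemma cyl_BV {n : ℕ} {Ω E F : Set (Rn n)} (hE : BVlocSetN Ω E) (hF : BVlocSetN Ω F) {R : ℝ}
    (hR : 0 ≤ R) : BVlocSet1 (Ω ×ˢ (univ : Set ℝ)) (cylComp E F R) := by
  intro A' hA'
  obtain ⟨ho, hc, hsub⟩ := hA'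
  set A : Set (Rn n) := Prod.fst '' A'
  have hcc : IsCompact (Prod.fst '' closure A') := hc.image continuous_fst
  have hcl : closure A ⊆ Prod.fst '' closure A' :=
    closure_minimal (image_mono subset_closure) hcc.isClosed
  have hcpt : IsCompact (closure A) := hcc.of_isClosed_subset isClosed_closure hcl
  have hA : CpCtd A Ω := ⟨isOpenMap_fst _ ho, hcpt, hcl.trans (by
    rintro _ ⟨z, hz, rfl⟩
    exact (hsub hz).1)⟩
  have hfin : volume A ≠ ⊤ :=
    ((measure_mono subset_closure).trans_lt hcpt.measure_lt_top).ne
  obtain ⟨T, hT⟩ := (hc.image continuous_snd).isBounded.exists_norm_le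
  set S := max (R + 1) (T + 1)
  have hS1 : R + 1 ≤ S := le_max_left _ _
  have hS2 : T + 1 ≤ S := le_max_right _ _
  refine ⟨_, upper_bdd (ψ := fun x => ‖x‖) (M := 1) (S := S) zero_le_one (fun ξ hξ =>
    ⟨(norm_fst_le_enorm1 ξ).trans hξ, (abs_snd_le_enorm1 ξ).trans hξ⟩) hA.1 hfin
    (hE A hA) (hF A hA) hR (by linarith) ?_⟩
  intro z hz
  refine ⟨⟨z, hz, rfl⟩, ?_⟩
  have := hT z.2 ⟨z, subset_closure hz, rfl⟩
  rw [Real.norm_eq_abs, abs_le] at this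
  exact ⟨by linarith [this.1], by linarith [this.2]⟩

open scoped Manifold ContDiff in
lemma selection {n : ℕ} {Φ : Rn1 n → ℝ} (hΦ : IsNorm1 Φ) {A : Set (Rn n)} (hA : IsOpen A)
    {η : Rn n → Rn n} (h : TestN A (phiOf Φ) η) {r : ℝ} (hr0 : 0 < r) (hr : r < 1) :
    ∃ g : Rn n → ℝ, ContDiff ℝ 1 g ∧ HasCompactSupport g ∧ tsupport g ⊆ A ∧
      ∀ x, Φ (r • η x, g x) ≤ 1 := by
  obtain ⟨hη, hs, hsub, hb⟩ := h
  obtain ⟨K, hK, hK1, hK2⟩ := exists_compact_between hs.isCompact hA hsub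
  let T : Rn n → Set ℝ := fun x => {c | Φ (r • η x, c) < 1 ∧ (x ∉ K → c = 0)}
  have hTc : ∀ x, Convex ℝ (T x) := by
    intro x a ha b hb s t hs ht hst
    refine ⟨?_, fun hx => by simp [ha.2 hx, hb.2 hx]⟩
    have hc : Convex ℝ {z : Rn1 n | Φ z < 1} := by simpa using hΦ.1.convex_lt 1
    have := hc ha.1 hb.1 hs ht hst
    simpa [← add_smul, hst] using this
  have hloc : ∀ x : Rn n, ∃ c : ℝ, ∀ᶠ y in nhds x, c ∈ T y := by
    intro x
    by_cases hx : x ∈ tsupport η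
    · obtain ⟨c, hc⟩ := phi_lift hΦ (hb x) hr0 hr
      refine ⟨c, ?_⟩
      have hcont : Continuous fun y => Φ (r • η y, c) :=
        hΦ.cont.comp ((hη.continuous.const_smul r).prodMk continuous_const)
      filter_upwards [hcont.continuousAt.eventually_lt continuousAt_const hc,
        isOpen_interior.mem_nhds (hK1 hx)] with y h1 h2
      exact ⟨h1, fun h3 => absurd (interior_subset h2) h3⟩
    · refine ⟨0, ?_⟩
      filter_upwards [(isClosed_tsupport η).isOpen_compl.mem_nhds hx] with y hy
      refine ⟨?_, fun _ => rfl⟩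
      have : η y = 0 := image_eq_zero_of_notMem_tsupport hy
      have h0 : ((0 : Rn n), (0 : ℝ)) = 0 := rfl
      simp [this, h0, hΦ.zero]
  obtain ⟨g, hg⟩ := exists_contMDiffMap_forall_mem_convex_of_local_const (n := 1)
    (I := 𝓘(ℝ, Rn n)) hTc hloc
  have hsup : Function.support g ⊆ K := by
    intro x hx
    by_contra hxK
    exact hx ((hg x).2 hxK)
  refine ⟨g, ?_, HasCompactSupport.of_support_subset_isCompact hK hsup,
    (closure_minimal hsup hK.isClosed).trans hK2, fun x => (hg x).1.le⟩
  exact g.contMDiff.contDiff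

lemma lower {n : ℕ} {Φ : Rn1 n → ℝ} (hΦ : IsNorm1 Φ) {E A : Set (Rn n)} (hA : IsOpen A)
    {v : ℝ} (hv : v ∈ perSetN (phiOf Φ) E A) {r : ℝ} (hr0 : 0 < r) (hr : r < 1) {R : ℝ}
    (hR : 0 < R) : ∃ m ≥ 2 * R, m * (r * v) ∈
      perSet1 Φ (E ×ˢ (univ : Set ℝ)) (A ×ˢ Ioo (-(R + 1)) (R + 1)) := by
  obtain ⟨η, hη, rfl⟩ := hv
  obtain ⟨g, hg, hgs, hgA, hgb⟩ := selection hΦ hA hη hr0 hr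
  obtain ⟨h, hs, hsub, hb⟩ := hη
  let χ : ContDiffBump (0:ℝ) := ⟨R, R + 1/2, hR, by linarith⟩
  have hχc : ContDiff ℝ 1 χ := χ.contDiff
  let ζ : Rn1 n → Rn1 n := fun z => χ z.2 • (r • η z.1, g z.1)
  have hζ : ContDiff ℝ 1 ζ := by
    have h1 := h.comp (contDiff_fst (𝕜 := ℝ) (E := Rn n) (F := ℝ))
    have h2 := hg.comp (contDiff_fst (𝕜 := ℝ) (E := Rn n) (F := ℝ))
    have h3 := hχc.comp (contDiff_snd (𝕜 := ℝ) (E := Rn n) (F := ℝ))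
    exact h3.smul ((h1.const_smul r).prodMk h2)
  set C : Set (Rn1 n) := (tsupport η ∪ tsupport g) ×ˢ Metric.closedBall (0:ℝ) (R + 1/2)
  have hC : IsCompact C := (hs.isCompact.union hgs.isCompact).prod (isCompact_closedBall _ _)
  have hsup : Function.support ζ ⊆ C := by
    intro z hz
    constructor
    · by_contra hcon
      rw [mem_union, not_or] at hcon
      apply hz
      simp [ζ, image_eq_zero_of_notMem_tsupport hcon.1, image_eq_zero_of_notMem_tsupport hcon.2]
    · by_contra hcon
      apply hz
      have : χ z.2 = 0 := χ.zero_of_le_dist (by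
        simp only [Metric.mem_closedBall, not_le] at hcon
        exact hcon.le)
      simp [ζ, this]
  have hζs : HasCompactSupport ζ := HasCompactSupport.of_support_subset_isCompact hC hsup
  have hCA : C ⊆ A ×ˢ Ioo (-(R + 1)) (R + 1) := by
    rintro z ⟨h1, h2⟩
    refine ⟨union_subset hsub hgA h1, ?_⟩
    rw [Metric.mem_closedBall, dist_zero_right, Real.norm_eq_abs, abs_le] at h2
    exact ⟨by linarith [h2.1], by linarith [h2.2]⟩
  refine ⟨∫ t, χ t, ?_, ζ, ⟨hζ, hζs, (closure_minimal hsup hC.isClosed).trans hCA,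
    fun z => hΦ.smul_le χ.nonneg χ.le_one (hgb _)⟩, ?_⟩
  · have h1 : ∫ t in Icc (-R) R, χ t = 2 * R := by
      rw [setIntegral_congr_fun (g := fun _ => (1:ℝ)) measurableSet_Icc]
      · rw [setIntegral_const, smul_eq_mul, Measure.real, Real.volume_Icc,
          ENNReal.toReal_ofReal (by linarith)]
        ring
      · intro t ht
        refine χ.one_of_mem_closedBall ?_
        rw [Metric.mem_closedBall, dist_zero_right, Real.norm_eq_abs, abs_le]
        exact ht
    rw [ge_iff_le, ← h1]
    exact setIntegral_le_integral χ.integrable (Eventually.of_forall fun t => χ.nonneg)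
  · have e1 : div1 ζ = fun z => hdiv ζ z + vdiv ζ z := rfl
    have e2 : ∀ t x, divN (fun y => (ζ (y, t)).1) x = χ t * (r * divN η x) := by
      intro t x
      have : (fun y => (ζ (y, t)).1) = fun y => (χ t * r) • η y := by
        funext y; simp [ζ, mul_smul]
      rw [this, divN_smul h, mul_assoc]
    rw [e1, integral_add (hdiv_int hζ hζs).integrableOn (vdiv_int hζ hζs).integrableOn,
      vdiv_univ hζ hζs, (hdiv_fubini hζ hζs E univ).2]
    simp only [e2, integral_const_mul, integral_mul_const, Measure.restrict_univ]
    ring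

theorem cylindrical_minimizer_section {n : ℕ} (Φ : Rn1 n → ℝ) (hΦ : IsNorm1 Φ)
    (Ω : Set (Rn n)) (hΩ : IsOpen Ω) (E : Set (Rn n)) (hE : BVlocSetN Ω E)
    (hmin : MinPer1 Φ (Ω ×ˢ (univ : Set ℝ)) (E ×ˢ (univ : Set ℝ))) :
    MinPerN (dualN (fun xs : Rn n => dual1 Φ (xs, (0:ℝ)))) Ω E := by
  refine ⟨hE, fun A hA F hF hc hcA => ?_⟩
  change PerN (phiOf Φ) E A ≤ PerN (phiOf Φ) F A
  obtain ⟨M, hM, hb⟩ := hΦ.bdd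
  have hfin : volume A ≠ ⊤ :=
    ((measure_mono subset_closure).trans_lt hA.2.1.measure_lt_top).ne
  have bE := phi_per_bdd hΦ (hE A hA)
  have bF := phi_per_bdd hΦ (hF A hA)
  have hz : ∀ G : Set (Rn n), (0:ℝ) ∈ perSetN (phiOf Φ) G A := by
    intro G
    refine ⟨fun _ => 0, ⟨contDiff_const, ?_, ?_, fun x => ?_⟩, ?_⟩
    · exact HasCompactSupport.zero
    · have : tsupport (fun _ : Rn n => (0 : Rn n)) = ∅ := by
        rw [tsupport_eq_empty_iff]; rfl
      simp [this]
    · exact phi_le hΦ (ξ := 0) (by simp [hΦ.zero])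
    · simp [divN]
  set p := PerN (phiOf Φ) F A with hp
  set q := PerN (phiOf Φ) E A with hq
  have hp0 : 0 ≤ p := le_csSup bF (hz F)
  have hq0 : 0 ≤ q := le_csSup bE (hz E)
  have hΨ : ∀ ξ, Φ ξ ≤ 1 → phiOf Φ ξ.1 ≤ 1 ∧ |ξ.2| ≤ M := fun ξ hξ =>
    ⟨phi_le hΦ hξ, (hb ξ hξ).2⟩
  set C := 4 * M * (volume A).toReal with hC
  have hC0 : 0 ≤ C := by positivity
  have main : ∀ R > 0, ∀ v ∈ perSetN (phiOf Φ) E A, ∀ r, 0 < r → r < 1 → 0 ≤ v →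
      2 * R * (r * v) ≤ 2 * R * p + 2 * q + C := by
    intro R hR v hv r hr0 hr hv0
    obtain ⟨m, hm, hmem⟩ := lower hΦ hA.1 hv hr0 hr hR
    have u1 := upper_bdd (S := R + 1) hM.le hΨ hA.1 hfin bE bE hR.le (by linarith)
      (Subset.refl _)
    have u2 := upper_bdd (S := R + 1) hM.le hΨ hA.1 hfin bE bF hR.le (by linarith)
      (Subset.refl _)
    rw [comp_self] at u1
    have k1 := le_csSup ⟨_, u1⟩ hmem
    have hcl : closure (symmDiff (E ×ˢ (univ : Set ℝ)) (cylComp E F R)) ⊆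
        closure (symmDiff E F) ×ˢ Icc (-R) R := by
      apply closure_minimal _ (isClosed_closure.prod isClosed_Icc)
      rintro ⟨x, t⟩ hxt
      have : x ∈ symmDiff E F ∧ t ∈ Icc (-R) R := by
        simp only [Set.mem_symmDiff, cylComp, mem_union, mem_prod, mem_univ, mem_compl_iff]
          at hxt ⊢
        tauto
      exact ⟨subset_closure this.1, this.2⟩
    have hk := hc.prod (isCompact_Icc (a := -R) (b := R))
    have k2 := hmin.2 (A ×ˢ Ioo (-(R + 1)) (R + 1)) ⟨hA.1.prod isOpen_Ioo, by
        rw [closure_prod_eq]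
        exact hA.2.1.prod (Metric.isBounded_Ioo _ _).isCompact_closure, by
        rw [closure_prod_eq]
        exact prod_mono hA.2.2 (subset_univ _)⟩ (cylComp E F R) (cyl_BV hE hF hR.le)
      (hk.of_isClosed_subset isClosed_closure hcl)
      (hcl.trans (prod_mono hcA (Icc_subset_Ioo (by linarith) (by linarith))))
    have k3 : Per1 Φ (cylComp E F R) (A ×ˢ Ioo (-(R + 1)) (R + 1)) ≤
        2 * R * p + 2 * q + C := by
      apply Real.sSup_le _ (by positivity)
      intro x hx
      have := u2 x hx
      rw [← hp, ← hq, ← hC] at this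
      linarith
    have k4 : 2 * R * (r * v) ≤ m * (r * v) :=
      mul_le_mul_of_nonneg_right hm (by positivity)
    exact k4.trans (k1.trans (k2.trans k3))
  apply csSup_le ⟨0, hz E⟩
  intro v hv
  by_contra hlt
  push Not at hlt
  have hv0 : 0 < v := hp0.trans_lt hlt
  set r := (p + v) / (2 * v) with hr
  have hrv : r * v = (p + v) / 2 := by rw [hr]; field_simp
  have hr0 : 0 < r := by positivity
  have hr1 : r < 1 := by rw [hr, div_lt_one (by positivity)]; linarith
  have hd : 0 < v - p := by linarith
  have := main ((2 * q + C + 1) / (v - p)) (by positivity) v hv r hr0 hr1 hv0.le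
  rw [hrv] at this
  have e : (2 * q + C + 1) / (v - p) * (v - p) = 2 * q + C + 1 := by field_simp
  nlinarith
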